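/- For every Schwartz function ψ : ℝ → ℂ and every n ∈ ℕ: the limits L_+^{(n+1)}(ψ) and L_−^{(n+1)}(ψ) exist, and for every N ∈ ℕ there exists C > 0 such that for all integers m ≥ 1, | ∫_ℝ ∫_ℝ e^{2πi m x q} · sgn(q) · q^n · τ(q) · ψ(x) dq dx − (i/(2πm))^{n+1} · n! · ( L_+^{(n+1)}(ψ) + L_−^{(n+1)}(ψ) ) | ≤ C·m^{−N}, where sgn(q) := 1 for q > 0, −1 for q < 0 and 0 at q = 0. -/

import Mathlib

open Real Filter Topology MeasureTheory

open scoped FourierTransform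

lemma aux_integrable (n : ℕ) (b : ℝ) (hb : 0 < b) :
    IntegrableOn (fun q : ℝ => q ^ n * Real.exp (-b * q)) (Set.Ioi 0) := by
  have h := integrableOn_rpow_mul_exp_neg_mul_rpow (p := 1) (s := n) (b := b)
    (by have : (0:ℝ) ≤ n := Nat.cast_nonneg n
        linarith) one_pos hb
  simpa using h

lemma aux_integrable_c (n : ℕ) (a : ℂ) (ha : a.re < 0) :
    IntegrableOn (fun q : ℝ => (q:ℂ) ^ n * Complex.exp (a * q)) (Set.Ioi 0) := by
  refine Integrable.mono' (aux_integrable n (-a.re) (by linarith)) ?_ ?_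
  · exact Continuous.aestronglyMeasurable (by fun_prop)
  · refine (ae_restrict_iff' measurableSet_Ioi).2 (ae_of_all _ fun q hq => ?_)
    have hq : 0 < q := hq
    simp [Complex.norm_exp, abs_of_pos hq]

lemma aux_tendsto (n : ℕ) (a : ℂ) (ha : a.re < 0) :
    Tendsto (fun q : ℝ => (q:ℂ) ^ n * Complex.exp (a * q)) atTop (𝓝 0) := by
  rw [tendsto_zero_iff_norm_tendsto_zero]
  have h := tendsto_rpow_mul_exp_neg_mul_atTop_nhds_zero n (-a.re) (by linarith)
  refine h.congr' ?_
  filter_upwards [eventually_gt_atTop 0] with q hq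
  simp [Complex.norm_exp, abs_of_pos hq]

lemma aux_laplace (n : ℕ) (a : ℂ) (ha : a.re < 0) :
    ∫ q in Set.Ioi (0:ℝ), (q:ℂ) ^ n * Complex.exp (a * q) = n.factorial * (-a⁻¹) ^ (n+1) := by
  have ha0 : a ≠ 0 := by rintro rfl; simp at ha
  induction n with
  | zero =>
    have := integral_exp_mul_complex_Ioi ha 0
    simp only [pow_zero, one_mul]
    rw [this]; simp [div_eq_mul_inv]
  | succ n ih =>
    have hd : ∀ x ∈ Set.Ioi (0:ℝ), HasDerivAt (fun q : ℝ => (q:ℂ) ^ (n+1))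
        (((n+1 : ℕ) : ℂ) * (x:ℂ) ^ n) x := by
      intro x _
      simpa using (hasDerivAt_pow (n+1) (x:ℂ)).comp_ofReal
    have he : ∀ x ∈ Set.Ioi (0:ℝ), HasDerivAt (fun q : ℝ => a⁻¹ * Complex.exp (a * q))
        (Complex.exp (a * x)) x := by
      intro x _
      have h1 : HasDerivAt (fun q : ℝ => a * (q:ℂ)) a x := by
        simpa using (Complex.ofRealCLM.hasDerivAt (x := x)).const_mul a
      have := (h1.cexp).const_mul a⁻¹
      rwa [mul_comm (Complex.exp _) a, inv_mul_cancel_left₀ ha0] at this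
    have key := integral_Ioi_mul_deriv_eq_deriv_mul (a := (0:ℝ)) (a' := (0:ℂ)) (b' := (0:ℂ)) hd he
      (aux_integrable_c (n+1) a ha) ?_ ?_ ?_
    · rw [key]
      have : ∀ x : ℝ, ((n+1 : ℕ) : ℂ) * (x:ℂ) ^ n * (a⁻¹ * Complex.exp (a * x))
          = (((n+1 : ℕ) : ℂ) * a⁻¹) * ((x:ℂ) ^ n * Complex.exp (a * x)) := fun x => by ring
      simp_rw [this]
      rw [integral_const_mul, ih, Nat.factorial_succ]
      push_cast; ring
    · have := (aux_integrable_c n a ha).const_mul (((n+1 : ℕ) : ℂ) * a⁻¹)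
      refine this.congr (ae_of_all _ fun x => ?_)
      simp only [Pi.mul_apply]; ring
    · have : Continuous ((fun q : ℝ => (q:ℂ) ^ (n+1)) * fun q : ℝ => a⁻¹ * Complex.exp (a * q)) := by
        fun_prop
      have h := (this.tendsto 0).mono_left (nhdsWithin_le_nhds (s := Set.Ioi 0))
      simpa using h
    · have := (aux_tendsto (n+1) a ha).const_mul a⁻¹
      rw [mul_zero] at this
      refine this.congr fun x => ?_
      simp only [Pi.mul_apply]; ring

lemma aux_finv (f : ℝ → ℂ) (q : ℝ) :
    𝓕⁻ f q = ∫ x : ℝ, Complex.exp (((2 * π * x * q : ℝ) : ℂ) * Complex.I) * f x := by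
  rw [Real.fourierInv_eq']
  congr 1; ext x
  simp only [smul_eq_mul, RCLike.inner_apply, conj_trivial]
  congr 4; ring

lemma aux_swap (f g : ℝ → ℂ) (hf : Integrable f) (μ : Measure ℝ) [SFinite μ] (hg : Integrable g μ)
    (c : ℝ) :
    ∫ x : ℝ, ∫ q : ℝ, Complex.exp (((2 * π * c * x * q : ℝ) : ℂ) * Complex.I) * g q * f x ∂μ
      = ∫ q, g q * 𝓕⁻ f (c * q) ∂μ := by
  rw [integral_integral_swap]
  · congr 1; ext q
    rw [aux_finv, ← integral_const_mul]
    congr 1; ext x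
    rw [show 2 * π * c * x * q = 2 * π * x * (c * q) by ring]; ring
  · have h := (hf.mul_prod hg).bdd_mul (c := 1)
      (f := fun z : ℝ × ℝ => Complex.exp (((2 * π * c * z.1 * z.2 : ℝ) : ℂ) * Complex.I))
      (Continuous.aestronglyMeasurable (by fun_prop))
      (ae_of_all _ fun z => by rw [Complex.norm_exp_ofReal_mul_I])
    refine h.congr (ae_of_all _ fun z => ?_)
    simp only [Function.uncurry]; ring

lemma aux_limit (f : ℝ → ℂ) (hf : Integrable f) (n : ℕ)
    (hF : IntegrableOn (fun q : ℝ => (q:ℂ) ^ n * 𝓕⁻ f q) (Set.Ioi 0)) :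
    Tendsto (fun ε : ℝ => ∫ x : ℝ, f x * ((x : ℂ) + (ε : ℂ) * Complex.I)⁻¹ ^ (n + 1)) (𝓝[>] 0)
      (𝓝 ((-(2 * π * Complex.I)) ^ (n+1) / n.factorial *
        ∫ q in Set.Ioi (0:ℝ), (q:ℂ) ^ n * 𝓕⁻ f q)) := by
  have hpi : (π : ℂ) ≠ 0 := by exact_mod_cast pi_ne_zero
  have hfac : (n.factorial : ℂ) ≠ 0 := by exact_mod_cast n.factorial_ne_zero
  have eq : ∀ ε : ℝ, 0 < ε → ∫ x : ℝ, f x * ((x : ℂ) + (ε : ℂ) * Complex.I)⁻¹ ^ (n + 1)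
      = (-(2 * π * Complex.I)) ^ (n+1) / n.factorial *
        ∫ q in Set.Ioi (0:ℝ), (Real.exp (-(2 * π * ε) * q) : ℂ) * ((q:ℂ) ^ n * 𝓕⁻ f q) := by
    intro ε hε
    have hg : Integrable (fun q : ℝ => (q:ℂ) ^ n * Complex.exp (((-(2 * π * ε) : ℝ) : ℂ) * q))
        (volume.restrict (Set.Ioi 0)) :=
      aux_integrable_c n _ (by rw [Complex.ofReal_re]; have := pi_pos; nlinarith [mul_pos pi_pos hε])
    have h := aux_swap f _ hf _ hg 1
    have h2 : ∀ q : ℝ, (Real.exp (-(2 * π * ε) * q) : ℂ) * ((q:ℂ) ^ n * 𝓕⁻ f q)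
       = (q:ℂ) ^ n * Complex.exp (((-(2 * π * ε) : ℝ) : ℂ) * q) * 𝓕⁻ f (1 * q) := by
      intro q; rw [one_mul]; push_cast; ring
    simp_rw [h2]
    rw [← h, ← integral_const_mul]
    congr 1; ext x
    have h3 : ∀ q : ℝ, Complex.exp (((2 * π * 1 * x * q : ℝ) : ℂ) * Complex.I) *
        ((q:ℂ) ^ n * Complex.exp (((-(2 * π * ε) : ℝ) : ℂ) * q)) * f x
        = f x * ((q:ℂ) ^ n * Complex.exp ((2 * π * Complex.I * (x + ε * Complex.I)) * q)) := by
      intro q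
      rw [show (2 * π * Complex.I * (x + ε * Complex.I)) * q
        = ((2 * π * 1 * x * q : ℝ) : ℂ) * Complex.I + ((-(2 * π * ε) : ℝ) : ℂ) * q by
          push_cast; linear_combination (2 * π * ε * q : ℂ) * Complex.I_sq, Complex.exp_add]
      ring
    simp_rw [h3]
    rw [integral_const_mul, aux_laplace n _ (by simp; positivity)]
    have hz : (x + ε * Complex.I : ℂ) ≠ 0 := by
      intro h; have := congrArg Complex.im h; simp at this; exact hε.ne' this
    have hI := Complex.I_ne_zero
    have : (-(2 * π * Complex.I)) ^ (n+1) * (-(2 * π * Complex.I * (x + ε * Complex.I))⁻¹) ^ (n+1)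
       = ((x + ε * Complex.I)⁻¹ : ℂ) ^ (n+1) := by
      rw [← mul_pow]; congr 1; field_simp
    rw [← this]; field_simp
  have lim : Tendsto (fun ε : ℝ => (-(2 * π * Complex.I)) ^ (n+1) / n.factorial *
        ∫ q in Set.Ioi (0:ℝ), (Real.exp (-(2 * π * ε) * q) : ℂ) * ((q:ℂ) ^ n * 𝓕⁻ f q)) (𝓝[>] 0)
      (𝓝 ((-(2 * π * Complex.I)) ^ (n+1) / n.factorial *
        ∫ q in Set.Ioi (0:ℝ), (q:ℂ) ^ n * 𝓕⁻ f q)) := by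
    refine Tendsto.const_mul _ ?_
    refine tendsto_integral_filter_of_dominated_convergence
      (fun q : ℝ => ‖(q:ℂ) ^ n * 𝓕⁻ f q‖) ?_ ?_ hF.norm ?_
    · refine Eventually.of_forall fun ε => ?_
      exact (Continuous.aestronglyMeasurable (by fun_prop)).mul hF.aestronglyMeasurable
    · filter_upwards [self_mem_nhdsWithin] with ε hε
      have hε : 0 < ε := hε
      refine (ae_restrict_iff' measurableSet_Ioi).2 (ae_of_all _ fun q hq => ?_)
      have hq : 0 < q := hq
      rw [norm_mul]
      refine mul_le_of_le_one_left (norm_nonneg _) ?_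
      rw [Complex.norm_real, Real.norm_eq_abs, Real.abs_exp, Real.exp_le_one_iff]
      have : 0 < 2 * π * ε * q := by positivity
      linarith
    · refine ae_of_all _ fun q => ?_
      have : Continuous fun ε : ℝ => (Real.exp (-(2 * π * ε) * q) : ℂ) * ((q:ℂ) ^ n * 𝓕⁻ f q) := by
        fun_prop
      have h := (this.tendsto 0).mono_left (nhdsWithin_le_nhds (s := Set.Ioi 0))
      simpa using h
  refine lim.congr' ?_
  filter_upwards [self_mem_nhdsWithin] with ε hε
  exact (eq ε hε).symm

theorem signed_oscillatory_integral_asymptotics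
    (δ : ℝ) (hδ : 0 < δ) (τ : ℝ → ℝ) (hτ : ContDiff ℝ (⊤ : ℕ∞) τ)
    (hτsupp : tsupport τ ⊆ Set.Ioo (-δ) δ)
    (hτone : ∀ x ∈ Set.Icc (-(δ/2)) (δ/2), τ x = 1)
    (ψ : SchwartzMap ℝ ℂ) (n : ℕ) :
    ∃ Lp Lm : ℂ,
      Tendsto (fun ε : ℝ =>
          ∫ x : ℝ, ψ x * ((x : ℂ) + (ε : ℂ) * Complex.I)⁻¹ ^ (n + 1))
        (𝓝[>] 0) (𝓝 Lp) ∧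
      Tendsto (fun ε : ℝ =>
          ∫ x : ℝ, ψ x * ((x : ℂ) - (ε : ℂ) * Complex.I)⁻¹ ^ (n + 1))
        (𝓝[>] 0) (𝓝 Lm) ∧
      ∀ N : ℕ, ∃ C : ℝ, 0 < C ∧ ∀ m : ℕ, 1 ≤ m →
        ‖(∫ x : ℝ, ∫ q : ℝ,
              Complex.exp (((2 * π * m * x * q : ℝ) : ℂ) * Complex.I) *
                ((Real.sign q : ℝ) : ℂ) * (q : ℂ) ^ n * ((τ q : ℝ) : ℂ) * ψ x)
            - (Complex.I / (2 * π * m)) ^ (n + 1) * (n.factorial : ℂ) * (Lp + Lm)‖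
          ≤ C / (m : ℝ) ^ N := by
  obtain ⟨G, hG⟩ : ∃ G : SchwartzMap ℝ ℂ, ∀ q, 𝓕⁻ (ψ : ℝ → ℂ) q = G q :=
    ⟨𝓕⁻ ψ, fun q => by rw [SchwartzMap.fourierInv_coe]⟩
  have hpi : (π : ℂ) ≠ 0 := by exact_mod_cast pi_ne_zero
  have hfac : (n.factorial : ℂ) ≠ 0 := by exact_mod_cast n.factorial_ne_zero
  have hψ : Integrable ψ := ψ.integrable
  have hGn : Integrable (fun q : ℝ => (q:ℂ) ^ n * G q) := by
    refine (G.integrable_pow_mul volume n).mono' (Continuous.aestronglyMeasurable (by fun_prop)) ?_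
    exact ae_of_all _ fun q => by simp
  have hGneg : Integrable (fun q : ℝ => (q:ℂ) ^ n * G (-q)) := by
    have := (hGn.comp_neg).const_mul ((-1)^n)
    refine this.congr (ae_of_all _ fun q => ?_)
    simp only [Complex.ofReal_neg]
    rw [← mul_assoc, ← mul_pow]; simp
  have hnegF : ∀ q, 𝓕⁻ (fun x : ℝ => ψ (-x)) q = G (-q) := by
    intro q
    rw [← hG]
    exact Real.fourierInv_comp_linearIsometry (LinearIsometryEquiv.neg ℝ) ψ q
  set c : ℂ := (-(2 * π * Complex.I)) ^ (n+1) / n.factorial with hc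
  have h1 := aux_limit ψ hψ n (by simp_rw [hG]; exact hGn.integrableOn)
  have h2 := aux_limit (fun x => ψ (-x)) hψ.comp_neg n (by simp_rw [hnegF]; exact hGneg.integrableOn)
  simp_rw [hG] at h1
  simp_rw [hnegF] at h2
  rw [← hc] at h1 h2
  refine ⟨_, (-1)^(n+1) * (c * ∫ q in Set.Ioi (0:ℝ), (q:ℂ) ^ n * G (-q)), h1, ?_, ?_⟩
  · refine (h2.const_mul ((-1)^(n+1))).congr fun ε => ?_
    rw [← integral_const_mul, ← integral_neg_eq_self]
    congr 1; ext x
    rw [neg_neg]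
    have : ((x:ℂ) - ε * Complex.I)⁻¹ = (-1) * (((-x : ℝ) : ℂ) + ε * Complex.I)⁻¹ := by
      rw [neg_one_mul, ← inv_neg]; congr 1; push_cast; ring
    rw [this, mul_pow]; ring
  -- the total main term
  let S : ℝ → ℂ := fun q => ((Real.sign q : ℝ) : ℂ) * (q:ℂ) ^ n
  have hsignm : Measurable Real.sign := by
    unfold Real.sign
    exact Measurable.ite measurableSet_Iio measurable_const
      (Measurable.ite measurableSet_Ioi measurable_const measurable_const)
  have hSm : Measurable S :=
    (Complex.measurable_ofReal.comp hsignm).mul (by fun_prop)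
  have hSb : ∀ q, ‖S q‖ ≤ ‖q‖ ^ n := by
    intro q
    simp only [S, norm_mul, norm_pow, Complex.norm_real]
    refine mul_le_of_le_one_left (by positivity) ?_
    rcases Real.sign_apply_eq q with h | h | h <;> simp [h]
  have hSG : Integrable (fun q => S q * G q) := by
    refine (G.integrable_pow_mul volume n).mono'
      (hSm.aestronglyMeasurable.mul G.continuous.aestronglyMeasurable) (ae_of_all _ fun q => ?_)
    rw [norm_mul]; gcongr; exact hSb q
  have hsplit : ∫ q, S q * G q = (∫ q in Set.Ioi (0:ℝ), (q:ℂ) ^ n * G q)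
      + (-1)^(n+1) * ∫ q in Set.Ioi (0:ℝ), (q:ℂ) ^ n * G (-q) := by
    rw [← integral_add_compl measurableSet_Ioi hSG (s := Set.Ioi 0)]
    congr 1
    · refine setIntegral_congr_fun measurableSet_Ioi fun q hq => ?_
      simp [S, Real.sign_of_pos hq]
    · have := integral_comp_neg_Ioi 0 (fun q => S q * G q)
      rw [Set.compl_Ioi]
      rw [neg_zero] at this
      rw [← this, ← integral_const_mul]
      refine setIntegral_congr_fun measurableSet_Ioi fun q hq => ?_
      have hq' : -q < 0 := neg_lt_zero.2 hq
      simp only [S, Real.sign_of_neg hq']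
      push_cast
      rw [neg_pow (q:ℂ)]; ring
  have hscale : ∀ m : ℕ, 1 ≤ m → (Complex.I / (2 * π * m)) ^ (n + 1) * (n.factorial : ℂ) *
      (c * (∫ q in Set.Ioi (0:ℝ), (q:ℂ) ^ n * G q) +
        (-1)^(n+1) * (c * ∫ q in Set.Ioi (0:ℝ), (q:ℂ) ^ n * G (-q)))
      = ∫ q, S q * G (m * q) := by
    intro m hm
    have hm0 : (0:ℝ) < m := by exact_mod_cast hm
    have hmc : (m:ℂ) ≠ 0 := by exact_mod_cast hm0.ne'
    have e1 : ∀ q : ℝ, S q * G (m * q) = ((m:ℂ)^n)⁻¹ * (S (m * q) * G (m * q)) := by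
      intro q
      have : Real.sign (m * q) = Real.sign q := by
        rcases lt_trichotomy q 0 with h | h | h
        · rw [Real.sign_of_neg h, Real.sign_of_neg (mul_neg_of_pos_of_neg hm0 h)]
        · simp [h]
        · rw [Real.sign_of_pos h, Real.sign_of_pos (mul_pos hm0 h)]
      simp only [S, this]
      push_cast
      rw [mul_pow]; field_simp
    simp_rw [e1]
    rw [integral_const_mul, Measure.integral_comp_mul_left (fun q => S q * G q) (m:ℝ), hsplit]
    rw [abs_of_pos (inv_pos.2 hm0), Complex.real_smul]
    have : (Complex.I / (2 * π * m)) ^ (n + 1) * (-(2 * π * Complex.I)) ^ (n+1)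
        = ((m:ℂ)^(n+1))⁻¹ := by
      rw [← mul_pow, ← inv_pow]; congr 1; field_simp; simp
    have h3 : (Complex.I / (2 * π * m)) ^ (n + 1) * (n.factorial : ℂ) * c = ((m:ℂ)^(n+1))⁻¹ := by
      rw [← this, hc]; field_simp
    push_cast
    generalize (∫ q in Set.Ioi (0:ℝ), (q:ℂ) ^ n * G q) = A at *
    generalize (∫ q in Set.Ioi (0:ℝ), (q:ℂ) ^ n * G (-q)) = B at *
    have h4 : ((m:ℂ)^(n+1))⁻¹ = ((m:ℂ)^n)⁻¹ * (m:ℂ)⁻¹ := by rw [pow_succ, mul_inv]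
    rw [h4] at h3
    linear_combination (A + (-1)^(n+1) * B) * h3
  -- the cutoff
  have hcs : HasCompactSupport τ := by
    refine HasCompactSupport.of_support_subset_isCompact (isCompact_Icc (a := -δ) (b := δ)) ?_
    exact (subset_tsupport τ).trans (hτsupp.trans Set.Ioo_subset_Icc_self)
  have hτc : Continuous τ := hτ.continuous
  obtain ⟨M, hM⟩ := hτc.bounded_above_of_compact_support hcs
  have hM0 : 0 ≤ M := (norm_nonneg _).trans (hM 0)
  have hSτ : Integrable (fun q => S q * (τ q : ℂ)) := by
    have hi : Integrable (fun q : ℝ => ‖q‖ ^ n * ‖τ q‖) :=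
      Continuous.integrable_of_hasCompactSupport (by fun_prop) (hcs.norm.mul_left)
    refine hi.mono' (hSm.aestronglyMeasurable.mul
      (Continuous.aestronglyMeasurable (by fun_prop))) (ae_of_all _ fun q => ?_)
    rw [norm_mul, Complex.norm_real]; gcongr; exact hSb q
  intro N
  let J : ℝ := ∫ y : ℝ, ‖y‖ ^ (n + N) * ‖G y‖
  have hJ : 0 ≤ J := integral_nonneg fun y => by positivity
  refine ⟨(M + 1) * (2/δ)^N * J + 1, by positivity, fun m hm => ?_⟩
  have hm0 : (0:ℝ) < m := by exact_mod_cast hm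
  have hm1 : (1:ℝ) ≤ m := by exact_mod_cast hm
  rw [hscale m hm]
  have hfub := aux_swap ψ _ hψ volume hSτ m
  simp_rw [hG] at hfub
  have e2 : (∫ x : ℝ, ∫ q : ℝ,
              Complex.exp (((2 * π * m * x * q : ℝ) : ℂ) * Complex.I) *
                ((Real.sign q : ℝ) : ℂ) * (q : ℂ) ^ n * ((τ q : ℝ) : ℂ) * ψ x)
      = ∫ q, S q * (τ q : ℂ) * G (m * q) := by
    rw [← hfub]
    congr 1; ext x; congr 1; ext q
    simp only [S]; ring
  have hJm : Integrable (fun q : ℝ => ‖(m:ℝ) * q‖ ^ (n + N) * ‖G (m * q)‖) :=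
    (G.integrable_pow_mul volume (n+N)).comp_mul_left' hm0.ne'
  have hGm : Integrable (fun q : ℝ => ‖(m:ℝ) * q‖ ^ n * ‖G (m * q)‖) :=
    (G.integrable_pow_mul volume n).comp_mul_left' hm0.ne'
  have hle : ∀ q : ℝ, ‖q‖ ^ n ≤ ‖(m:ℝ) * q‖ ^ n := by
    intro q
    gcongr
    rw [norm_mul, Real.norm_of_nonneg hm0.le]
    exact le_mul_of_one_le_left (norm_nonneg _) hm1
  have i1 : Integrable (fun q : ℝ => S q * G (m * q)) := by
    refine hGm.mono' (hSm.aestronglyMeasurable.mul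
      (Continuous.aestronglyMeasurable (by fun_prop))) (ae_of_all _ fun q => ?_)
    rw [norm_mul]; gcongr; exact (hSb q).trans (hle q)
  have i2 : Integrable (fun q : ℝ => S q * (τ q : ℂ) * G (m * q)) := by
    have := i1.bdd_mul (c := M) (f := fun q => (τ q : ℂ))
      (Continuous.aestronglyMeasurable (by fun_prop))
      (ae_of_all _ fun q => by rw [Complex.norm_real]; exact hM q)
    refine this.congr (ae_of_all _ fun q => ?_)
    simp only; ring
  rw [e2, ← integral_sub i2 i1]
  have hpt : ∀ q : ℝ, ‖S q * (τ q : ℂ) * G (m * q) - S q * G (m * q)‖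
      ≤ ((M + 1) * (2/δ)^N * ((m:ℝ)^N)⁻¹) * (‖(m:ℝ) * q‖ ^ (n + N) * ‖G (m * q)‖) := by
    intro q
    rw [show S q * (τ q : ℂ) * G (m * q) - S q * G (m * q)
      = ((τ q : ℂ) - 1) * (S q * G (m * q)) by ring, norm_mul, norm_mul]
    by_cases hq : q ∈ Set.Icc (-(δ/2)) (δ/2)
    · rw [hτone q hq]; simp; positivity
    · have hq2 : δ / 2 ≤ ‖q‖ := by
        by_contra! h
        rw [Real.norm_eq_abs, abs_lt] at h
        exact hq ⟨h.1.le, h.2.le⟩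
      have hτ1 : ‖(τ q : ℂ) - 1‖ ≤ M + 1 := by
        refine (norm_sub_le _ _).trans ?_
        rw [Complex.norm_real, norm_one]; gcongr; exact hM q
      have hone : 1 ≤ (2/δ)^N * ‖q‖^N := by
        rw [← mul_pow]
        refine one_le_pow₀ ?_
        rw [div_mul_eq_mul_div, le_div_iff₀ hδ]; linarith
      have hmN : ‖(m:ℝ) * q‖ ^ (n + N) = ‖(m:ℝ) * q‖ ^ n * ((m:ℝ)^N * ‖q‖^N) := by
        rw [pow_add, norm_mul, Real.norm_of_nonneg hm0.le, mul_pow _ _ N]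
      rw [hmN]
      have hmne : (m:ℝ)^N ≠ 0 := by positivity
      calc ‖(τ q : ℂ) - 1‖ * (‖S q‖ * ‖G (m * q)‖)
          ≤ (M + 1) * ((‖(m:ℝ) * q‖ ^ n * ((2/δ)^N * ‖q‖^N)) * ‖G (m * q)‖) := by
            gcongr
            exact ((hSb q).trans (hle q)).trans (le_mul_of_one_le_right (by positivity) hone)
        _ = _ := by
            field_simp
  refine (norm_integral_le_of_norm_le (hJm.const_mul _) (ae_of_all _ hpt)).trans ?_
  rw [integral_const_mul, Measure.integral_comp_mul_left (fun y : ℝ => ‖y‖ ^ (n + N) * ‖G y‖) (m:ℝ),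
    abs_of_pos (inv_pos.2 hm0), smul_eq_mul]
  change (M + 1) * (2/δ)^N * ((m:ℝ)^N)⁻¹ * ((m:ℝ)⁻¹ * J) ≤ _
  rw [div_eq_mul_inv _ ((m:ℝ)^N)]
  have hinv : (m:ℝ)⁻¹ ≤ 1 := inv_le_one_of_one_le₀ hm1
  calc (M + 1) * (2/δ)^N * ((m:ℝ)^N)⁻¹ * ((m:ℝ)⁻¹ * J)
      ≤ (M + 1) * (2/δ)^N * ((m:ℝ)^N)⁻¹ * (1 * J) := by gcongr
    _ = ((M + 1) * (2/δ)^N * J) * ((m:ℝ)^N)⁻¹ := by ring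
    _ ≤ _ := mul_le_mul_of_nonneg_right (by linarith) (by positivity)
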